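/- Let A_1, …, A_5 be n×n quaternion Hermitian matrices. Then { (xᴴA_1x, …, xᴴA_5x) : x ∈ ℍⁿ } = { (A_1 • X, …, A_5 • X) : X ∈ ℍ^{n×n} Hermitian positive semidefinite } as subsets of ℝ⁵. -/

import Mathlib

open Matrix Quaternion BigOperators

/-- The quadratic form `xᴴ A x` of a quaternion matrix. -/
noncomputable def qform {n : ℕ} (A : Matrix (Fin n) (Fin n) ℍ[ℝ]) (x : Fin n → ℍ[ℝ]) : ℍ[ℝ] :=
  star x ⬝ᵥ A.mulVec x

/-- The inner product `A • B = Re (tr (Aᴴ B))` of quaternion matrices. -/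
noncomputable def qdot {n : ℕ} (A B : Matrix (Fin n) (Fin n) ℍ[ℝ]) : ℝ :=
  (Matrix.trace (Aᴴ * B)).re

/-- A quaternion matrix is Hermitian positive semidefinite:
it is Hermitian and `xᴴ X x ≥ 0` for all `x`. -/
def qPSD {n : ℕ} (X : Matrix (Fin n) (Fin n) ℍ[ℝ]) : Prop :=
  X.IsHermitian ∧ ∀ x : Fin n → ℍ[ℝ], 0 ≤ (star x ⬝ᵥ X.mulVec x).re

/-- `X` can be written as a sum of `r` quaternion rank-one outer products. -/
def qDecomp {n : ℕ} (X : Matrix (Fin n) (Fin n) ℍ[ℝ]) (r : ℕ) : Prop :=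
  ∃ v : Fin r → (Fin n → ℍ[ℝ]), X = ∑ i, vecMulVec (v i) (star (v i))

/-- `X` has rank `r`: `r` is the least number of rank-one terms summing to `X`. -/
def qRank {n : ℕ} (X : Matrix (Fin n) (Fin n) ℍ[ℝ]) (r : ℕ) : Prop :=
  qDecomp X r ∧ ∀ s : ℕ, qDecomp X s → r ≤ s

theorem Quaternion.re_sum {ι : Type*} (S : Finset ι) (f : ι → ℍ[ℝ]) :
    (∑ i ∈ S, f i).re = ∑ i ∈ S, (f i).re :=
  map_sum (QuaternionAlgebra.reₗ (-1 : ℝ) 0 (-1)) f S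

theorem re_dotProduct_mulVec {n : ℕ} (A : Matrix (Fin n) (Fin n) ℍ[ℝ]) (x y : Fin n → ℍ[ℝ]) :
    (star x ⬝ᵥ A.mulVec y).re = ∑ i, ∑ j, (star (x i) * (A i j * y j)).re := by
  simp only [dotProduct, mulVec, Finset.mul_sum, Pi.star_apply]
  simp_rw [Quaternion.re_sum]

theorem star_dotProduct_mulVec_of_isHermitian {n : ℕ} {A : Matrix (Fin n) (Fin n) ℍ[ℝ]}
    (hA : A.IsHermitian) (x y : Fin n → ℍ[ℝ]) :
    star x ⬝ᵥ A.mulVec y = star (star y ⬝ᵥ A.mulVec x) := by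
  rw [star_dotProduct, star_mulVec, hA.eq, dotProduct_mulVec]

theorem coe_re_qform {n : ℕ} {A : Matrix (Fin n) (Fin n) ℍ[ℝ]} (hA : A.IsHermitian)
    (x : Fin n → ℍ[ℝ]) : (((qform A x).re : ℝ) : ℍ[ℝ]) = qform A x :=
  (Quaternion.star_eq_self.mp (star_dotProduct_mulVec_of_isHermitian hA x x).symm).symm

/-- The standard real basis `1, i, j, k` of the quaternions. -/
def quaternionUnit : Fin 4 → ℍ[ℝ] :=
  ![⟨1, 0, 0, 0⟩, ⟨0, 1, 0, 0⟩, ⟨0, 0, 1, 0⟩, ⟨0, 0, 0, 1⟩]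

/-- The quaternion with prescribed real coordinates. -/
def quaternionOfCoords (b : Fin 4 → ℝ) : ℍ[ℝ] := ⟨b 0, b 1, b 2, b 3⟩

theorem re_star_mul_mul_ofCoords (a : ℍ[ℝ]) (b c : Fin 4 → ℝ) :
    (star (quaternionOfCoords b) * (a * quaternionOfCoords c)).re =
      ∑ s, ∑ t, (star (quaternionUnit s) * (a * quaternionUnit t)).re * (b s * c t) := by
  obtain ⟨q, hq⟩ : ∃ q, q = quaternionOfCoords b := ⟨_, rfl⟩
  obtain ⟨r, hr⟩ : ∃ r, r = quaternionOfCoords c := ⟨_, rfl⟩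
  have hb : b = ![q.re, q.imI, q.imJ, q.imK] := by
    ext s; fin_cases s <;> simp [hq, quaternionOfCoords]
  have hc : c = ![r.re, r.imI, r.imJ, r.imK] := by
    ext s; fin_cases s <;> simp [hr, quaternionOfCoords]
  rw [← hq, ← hr, hb, hc]
  simp [quaternionUnit, Fin.sum_univ_four, Quaternion.re_mul]
  ring

theorem sum_re_star_unit_mul_mul (a x : ℍ[ℝ]) :
    ∑ s, ∑ t, (star (quaternionUnit s) * (a * quaternionUnit t)).re *
      (star (quaternionUnit s) * (x * quaternionUnit t)).re = 4 * (star a * x).re := by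
  simp [quaternionUnit, Fin.sum_univ_four, Quaternion.re_mul]
  ring

/-- The real matrix of left multiplication by a quaternion matrix. -/
noncomputable def realification {n : ℕ} (X : Matrix (Fin n) (Fin n) ℍ[ℝ]) :
    Matrix (Fin n × Fin 4) (Fin n × Fin 4) ℝ :=
  Matrix.of fun p q => (star (quaternionUnit p.2) * (X p.1 q.1 * quaternionUnit q.2)).re

theorem re_dotProduct_mulVec_ofCoords {n : ℕ} (A : Matrix (Fin n) (Fin n) ℍ[ℝ])
    (b : Fin n × Fin 4 → ℝ) :
    (star (fun i => quaternionOfCoords fun s => b (i, s)) ⬝ᵥ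
      A.mulVec fun i => quaternionOfCoords fun s => b (i, s)).re =
      ∑ p, ∑ q, realification A p q * (b p * b q) := by
  rw [re_dotProduct_mulVec]
  simp_rw [re_star_mul_mul_ofCoords, Fintype.sum_prod_type, realification, Matrix.of_apply]
  exact Finset.sum_congr rfl fun i _ => Finset.sum_comm

theorem realification_posSemidef {n : ℕ} {X : Matrix (Fin n) (Fin n) ℍ[ℝ]} (hX : qPSD X) :
    (realification X).PosSemidef := by
  refine Matrix.PosSemidef.of_dotProduct_mulVec_nonneg ?_ fun b => ?_
  · ext p q
    have h : X q.1 p.1 = star (X p.1 q.1) := (hX.1.apply q.1 p.1).symm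
    rw [conjTranspose_apply, star_trivial, realification, Matrix.of_apply, Matrix.of_apply, h,
      ← Quaternion.re_star, star_mul, star_mul, star_star, star_star, mul_assoc]
  · have h := hX.2 fun i => quaternionOfCoords fun s => b (i, s)
    rw [re_dotProduct_mulVec_ofCoords] at h
    refine h.trans_eq ?_
    simp only [dotProduct, mulVec, Finset.mul_sum, Pi.star_apply, star_trivial]
    exact Finset.sum_congr rfl fun p _ => Finset.sum_congr rfl fun q _ => by ring

theorem qdot_eq_sum {n : ℕ} (A X : Matrix (Fin n) (Fin n) ℍ[ℝ]) :
    qdot A X = ∑ i, ∑ j, (star (A i j) * X i j).re := by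
  rw [qdot, Matrix.trace, Quaternion.re_sum, Finset.sum_comm]
  simp [Matrix.mul_apply, Quaternion.re_sum]

theorem sum_realification_mul {n : ℕ} (A X : Matrix (Fin n) (Fin n) ℍ[ℝ]) :
    ∑ p, ∑ q, realification A p q * realification X p q = 4 * qdot A X := by
  simp_rw [qdot_eq_sum, Finset.mul_sum, ← sum_re_star_unit_mul_mul, Fintype.sum_prod_type,
    realification, Matrix.of_apply]
  exact Finset.sum_congr rfl fun i _ => Finset.sum_comm

theorem exists_sum_qform_eq_qdot {n : ℕ} {X : Matrix (Fin n) (Fin n) ℍ[ℝ]} (hX : qPSD X) :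
    ∃ v : Fin n × Fin 4 → Fin n → ℍ[ℝ], ∀ A : Matrix (Fin n) (Fin n) ℍ[ℝ],
      ∑ m, (qform A (v m)).re = 4 * qdot A X := by
  obtain ⟨B, hB⟩ : ∃ B : Matrix (Fin n × Fin 4) (Fin n × Fin 4) ℝ,
      realification X = Bᴴ * B := by
    open scoped MatrixOrder in
    exact CStarAlgebra.nonneg_iff_eq_star_mul_self.mp (realification_posSemidef hX).nonneg
  refine ⟨fun m i => quaternionOfCoords fun s => B m (i, s), fun A => ?_⟩
  simp_rw [qform, re_dotProduct_mulVec_ofCoords]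
  rw [← sum_realification_mul, Finset.sum_comm]
  refine Finset.sum_congr rfl fun p _ => ?_
  rw [Finset.sum_comm]
  refine Finset.sum_congr rfl fun q _ => ?_
  rw [hB, Matrix.mul_apply, Finset.mul_sum]
  simp

/-- A `2 × 2` quaternion Hermitian matrix with zero determinant and nonnegative trace
is a rank-one outer product. -/
theorem exists_outer_product {α γ : ℝ} {β : ℍ[ℝ]} (htr : 0 ≤ α + γ)
    (hdet : α * γ = normSq β) :
    ∃ a b : ℍ[ℝ], normSq a = α ∧ normSq b = γ ∧ b * star a = β := by
  have hn : 0 ≤ normSq β := Quaternion.normSq_nonneg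
  rcases le_or_gt α 0 with hα | hα
  · have hα0 : α = 0 := by nlinarith
    subst hα0
    have hβ : β = 0 := Quaternion.normSq_eq_zero.mp (by linarith)
    refine ⟨0, ((√γ : ℝ) : ℍ[ℝ]), by simp, ?_, by simp [hβ]⟩
    rw [Quaternion.normSq_coe, Real.sq_sqrt (by linarith)]
  · have hs : √α ≠ 0 := (Real.sqrt_pos.mpr hα).ne'
    refine ⟨((√α : ℝ) : ℍ[ℝ]), (√α)⁻¹ • β, ?_, ?_, ?_⟩
    · rw [Quaternion.normSq_coe, Real.sq_sqrt hα.le]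
    · rw [Quaternion.normSq_smul, ← hdet, inv_pow, Real.sq_sqrt hα.le]
      field_simp
    · rw [Quaternion.star_coe, Quaternion.mul_coe_eq_smul, smul_smul, mul_inv_cancel₀ hs, one_smul]

/-- A nonzero Hermitian perturbation of the `2 × 2` identity reaches, after scaling,
a positive semidefinite singular matrix. -/
theorem exists_scale_singular {p s N : ℝ} (hN : 0 ≤ N) (h0 : p ≠ 0 ∨ s ≠ 0 ∨ N ≠ 0) :
    ∃ t : ℝ, 0 ≤ (1 + t * p) + (1 + t * s) ∧ (1 + t * p) * (1 + t * s) = t ^ 2 * N := by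
  wlog hps : p + s ≤ 0 generalizing p s
  · obtain ⟨t, h1, h2⟩ := this (p := -p) (s := -s) (by simpa using h0) (by linarith)
    exact ⟨-t, by linarith, by linarith⟩
  set D := √((p - s) ^ 2 + 4 * N)
  have hD2 : D ^ 2 = (p - s) ^ 2 + 4 * N := Real.sq_sqrt (by positivity)
  have hD0 : 0 ≤ D := Real.sqrt_nonneg _
  have hpos : 0 < D - (p + s) := by
    by_contra! hle
    have hDz : D = 0 := by linarith
    have hsum : p + s = 0 := by linarith
    rw [hDz] at hD2
    have hNz : N = 0 := by nlinarith [sq_nonneg (p - s)]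
    have hd : p - s = 0 := by
      have : (p - s) ^ 2 = 0 := by nlinarith
      exact pow_eq_zero_iff two_ne_zero |>.mp this
    rcases h0 with h | h | h
    · exact h (by linarith)
    · exact h (by linarith)
    · exact h hNz
  refine ⟨2 / (D - (p + s)), ?_, ?_⟩
  · have : (1 + 2 / (D - (p + s)) * p) + (1 + 2 / (D - (p + s)) * s)
        = 2 * D / (D - (p + s)) := by
      field_simp
      ring
    rw [this]
    positivity
  · field_simp
    linear_combination hD2

theorem exists_outer_product_map_eq (L : ℝ × ℝ × ℍ[ℝ] →ₗ[ℝ] Fin 5 → ℝ) :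
    ∃ a b : ℍ[ℝ], L (normSq a, normSq b, b * star a) = L (1, 1, 0) := by
  have hker : LinearMap.ker L ≠ ⊥ := by
    apply LinearMap.ker_ne_bot_of_finrank_lt
    simp [Quaternion.finrank_eq_four]
  obtain ⟨⟨p, s, q⟩, hL, hne⟩ := (Submodule.ne_bot_iff _).mp hker
  have h0 : p ≠ 0 ∨ s ≠ 0 ∨ normSq q ≠ 0 := by
    by_contra! h
    exact hne (by simp [h.1, h.2.1, Quaternion.normSq_eq_zero.mp h.2.2])
  obtain ⟨t, htr, hdet⟩ := exists_scale_singular Quaternion.normSq_nonneg h0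
  obtain ⟨a, b, ha, hb, hab⟩ := exists_outer_product (β := t • q) htr
    (by rw [hdet, Quaternion.normSq_smul])
  refine ⟨a, b, ?_⟩
  have hsplit : ((1 + t * p, 1 + t * s, t • q) : ℝ × ℝ × ℍ[ℝ]) = (1, 1, 0) + t • (p, s, q) := by
    simp
  rw [ha, hb, hab, hsplit, map_add, map_smul, LinearMap.mem_ker.mp hL, smul_zero, add_zero]

theorem re_qform_mul_add_mul {n : ℕ} {A : Matrix (Fin n) (Fin n) ℍ[ℝ]} (hA : A.IsHermitian)
    (u v : Fin n → ℍ[ℝ]) (a b : ℍ[ℝ]) :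
    (qform A fun i => u i * a + v i * b).re =
      normSq a * (qform A u).re + normSq b * (qform A v).re +
        2 * ((star u ⬝ᵥ A.mulVec v) * (b * star a)).re := by
  have hexp : (qform A fun i => u i * a + v i * b) =
      star a * qform A u * a + star a * (star u ⬝ᵥ A.mulVec v) * b +
        (star b * (star v ⬝ᵥ A.mulVec u) * a + star b * qform A v * b) := by
    simp only [qform, dotProduct, mulVec, Finset.mul_sum, Finset.sum_mul, Pi.star_apply,
      ← Finset.sum_add_distrib]
    refine Finset.sum_congr rfl fun i _ => Finset.sum_congr rfl fun j _ => ?_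
    simp only [star_add, star_mul]
    noncomm_ring
  rw [hexp, star_dotProduct_mulVec_of_isHermitian hA v u, ← coe_re_qform hA u, ← coe_re_qform hA v]
  generalize star u ⬝ᵥ A.mulVec v = Q
  simp [Quaternion.re_mul, Quaternion.normSq_def']
  ring

/-- The joint range of five Hermitian quaternion forms is closed under addition. -/
theorem exists_re_qform_eq_add {n : ℕ} {A : Fin 5 → Matrix (Fin n) (Fin n) ℍ[ℝ]}
    (hA : ∀ k, (A k).IsHermitian) (u v : Fin n → ℍ[ℝ]) :
    ∃ w : Fin n → ℍ[ℝ], ∀ k,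
      (qform (A k) w).re = (qform (A k) u).re + (qform (A k) v).re := by
  let L : ℝ × ℝ × ℍ[ℝ] →ₗ[ℝ] Fin 5 → ℝ :=
    { toFun := fun z k => z.1 * (qform (A k) u).re + z.2.1 * (qform (A k) v).re +
        2 * ((star u ⬝ᵥ (A k).mulVec v) * z.2.2).re
      map_add' := fun y z => by
        ext k
        simp only [Prod.fst_add, Prod.snd_add, mul_add, Quaternion.re_add, Pi.add_apply]
        ring
      map_smul' := fun c z => by
        ext k
        simp only [Prod.smul_fst, Prod.smul_snd, mul_smul_comm, Quaternion.re_smul, Pi.smul_apply,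
          smul_eq_mul, RingHom.id_apply]
        ring }
  obtain ⟨a, b, hab⟩ := exists_outer_product_map_eq L
  refine ⟨fun i => u i * a + v i * b, fun k => ?_⟩
  rw [re_qform_mul_add_mul (hA k)]
  simpa [L] using congrFun hab k

theorem exists_re_qform_eq_sum {n : ℕ} {A : Fin 5 → Matrix (Fin n) (Fin n) ℍ[ℝ]}
    (hA : ∀ k, (A k).IsHermitian) {ι : Type*} (S : Finset ι) (v : ι → Fin n → ℍ[ℝ]) :
    ∃ w : Fin n → ℍ[ℝ], ∀ k, (qform (A k) w).re = ∑ m ∈ S, (qform (A k) (v m)).re := by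
  classical
  induction S using Finset.induction_on with
  | empty => exact ⟨0, fun k => by simp [qform]⟩
  | insert m S hm ih =>
    obtain ⟨w, hw⟩ := ih
    obtain ⟨w', hw'⟩ := exists_re_qform_eq_add hA (v m) w
    exact ⟨w', fun k => by rw [hw', hw, Finset.sum_insert hm]⟩

theorem qform_smul {n : ℕ} (A : Matrix (Fin n) (Fin n) ℍ[ℝ]) (c : ℝ) (x : Fin n → ℍ[ℝ]) :
    qform A (c • x) = c ^ 2 • qform A x := by
  simp only [qform, dotProduct, mulVec, Finset.mul_sum, Finset.smul_sum, Pi.star_apply,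
    Pi.smul_apply, Quaternion.star_smul, smul_mul_assoc, mul_smul_comm, smul_smul, pow_two]

theorem qPSD_vecMulVec_star {n : ℕ} (x : Fin n → ℍ[ℝ]) : qPSD (vecMulVec x (star x)) := by
  refine ⟨by rw [Matrix.IsHermitian, conjTranspose_vecMulVec, star_star], fun y => ?_⟩
  have h : star y ⬝ᵥ (vecMulVec x (star x)).mulVec y = star (star x ⬝ᵥ y) * (star x ⬝ᵥ y) := by
    rw [← star_dotProduct]
    simp only [dotProduct, mulVec, vecMulVec_apply, Finset.mul_sum, Finset.sum_mul, mul_assoc]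
    exact Finset.sum_comm
  rw [h, Quaternion.star_mul_self, Quaternion.re_coe]
  exact Quaternion.normSq_nonneg

theorem qdot_vecMulVec_star {n : ℕ} {A : Matrix (Fin n) (Fin n) ℍ[ℝ]} (hA : A.IsHermitian)
    (x : Fin n → ℍ[ℝ]) : qdot A (vecMulVec x (star x)) = (qform A x).re := by
  rw [qdot_eq_sum, qform, re_dotProduct_mulVec, Finset.sum_comm]
  refine Finset.sum_congr rfl fun i _ => Finset.sum_congr rfl fun j _ => ?_
  rw [← hA.apply i j, vecMulVec_apply, Pi.star_apply]
  generalize star (A j i) = a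
  simp [Quaternion.re_mul]
  ring

/-- The joint range of five quaternion Hermitian forms equals the set of joint
inner products with Hermitian positive semidefinite matrices. -/
theorem joint_range_eq_psd_inner_products {n : ℕ}
    (A : Fin 5 → Matrix (Fin n) (Fin n) ℍ[ℝ]) (hA : ∀ k, (A k).IsHermitian) :
    {y : Fin 5 → ℝ | ∃ x : Fin n → ℍ[ℝ], ∀ k, ((y k : ℝ) : ℍ[ℝ]) = qform (A k) x}
      = {y : Fin 5 → ℝ |
          ∃ X : Matrix (Fin n) (Fin n) ℍ[ℝ], qPSD X ∧ ∀ k, y k = qdot (A k) X} := by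
  ext y
  constructor
  · rintro ⟨x, hx⟩
    refine ⟨vecMulVec x (star x), qPSD_vecMulVec_star x, fun k => ?_⟩
    rw [qdot_vecMulVec_star (hA k), ← hx k, Quaternion.re_coe]
  · rintro ⟨X, hX, hy⟩
    obtain ⟨v, hv⟩ := exists_sum_qform_eq_qdot hX
    obtain ⟨w, hw⟩ := exists_re_qform_eq_sum hA Finset.univ v
    refine ⟨(1 / 2 : ℝ) • w, fun k => ?_⟩
    rw [← coe_re_qform (hA k), qform_smul, Quaternion.re_smul, hw, hv, hy, smul_eq_mul]
    congr 1
    ring
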